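/- arXiv:1210.4514 — 6 statements merged into one kernel-verified Lean document; each statement's English description precedes it below -/
import Mathlib

section
/- Let R be a commutative ring, g ∈ R, and let S : ℕ → R satisfy the recursion S_n = 1 + g·S_n·(S_{n+1} + S_n + S_{n−1}) for all n ≥ 1. Then the quantity φ(S_n, S_{n+1}) is independent of n: for all n ≥ 0, φ(S_n, S_{n+1}) = φ(S_0, S_1), where φ(x,y) = x·y·(1 − g·(x+y)) − x − y. -/
/-- `φ(x,y) = xy(1 - g(x+y)) - x - y` is a conserved quantity of the
recursion `S_n = 1 + g S_n (S_{n+1} + S_n + S_{n-1})`. -/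
theorem conserved_quantity_map_recursion
    (R : Type*) [CommRing R] (g : R) (S : ℕ → R)
    (hS : ∀ n : ℕ, 1 ≤ n → S n = 1 + g * S n * (S (n + 1) + S n + S (n - 1))) :
    ∀ n : ℕ,
      S n * S (n + 1) * (1 - g * (S n + S (n + 1))) - S n - S (n + 1)
        = S 0 * S 1 * (1 - g * (S 0 + S 1)) - S 0 - S 1 := by
  intro n
  induction n with
  | zero => rfl
  | succ k ih =>
    have h := hS (k + 1) (by omega)
    simp only [Nat.add_sub_cancel] at h
    rw [← ih]
    linear_combination (S (k + 1 + 1) - S k) * h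
end

section
/- Let g ∈ ℝ and let S : ℕ → ℝ satisfy the recursion S_n = 1 + g·S_n·(S_{n+1} + S_n + S_{n−1}) for all n ≥ 1, and suppose S_n converges to a limit L ∈ ℝ as n → ∞. Then for all n ≥ 0, φ(S_n, S_{n+1}) = φ(L, L) = L²·(1 − 2gL) − 2L, where φ(x,y) = x·y·(1 − g·(x+y)) − x − y. -/
/-- if `S` satisfies the recursion `S_n = 1 + g S_n (S_{n+1} + S_n + S_{n-1})`
and converges to `L`, then the conserved quantity `φ(S_n, S_{n+1})` equals
`φ(L,L) = L²(1 - 2gL) - 2L` for all `n`, where `φ(x,y) = xy(1 - g(x+y)) - x - y`. -/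
theorem conserved_quantity_limit_value
    (g : ℝ) (S : ℕ → ℝ)
    (hS : ∀ n : ℕ, 1 ≤ n → S n = 1 + g * S n * (S (n + 1) + S n + S (n - 1)))
    (L : ℝ) (hL : Filter.Tendsto S Filter.atTop (nhds L)) :
    ∀ n : ℕ,
      S n * S (n + 1) * (1 - g * (S n + S (n + 1))) - S n - S (n + 1)
        = L ^ 2 * (1 - 2 * g * L) - 2 * L := by
  have step : ∀ n : ℕ,
      S (n + 1) * S (n + 1 + 1) * (1 - g * (S (n + 1) + S (n + 1 + 1))) - S (n + 1) - S (n + 1 + 1)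
        = S n * S (n + 1) * (1 - g * (S n + S (n + 1))) - S n - S (n + 1) := by
    intro n
    have h := hS (n + 1) (by omega)
    rw [Nat.add_sub_cancel] at h
    linear_combination (S (n + 1 + 1) - S n) * h
  have hconst : ∀ n : ℕ,
      S n * S (n + 1) * (1 - g * (S n + S (n + 1))) - S n - S (n + 1)
        = S 0 * S (0 + 1) * (1 - g * (S 0 + S (0 + 1))) - S 0 - S (0 + 1) := by
    intro n
    induction n with
    | zero => rfl
    | succ k ih => rw [step k, ih]
  have hL1 : Filter.Tendsto (fun n => S (n + 1)) Filter.atTop (nhds L) :=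
    hL.comp (Filter.tendsto_add_atTop_nat 1)
  have hlim := (((hL.mul hL1).mul
    (((hL.add hL1).const_mul g).const_sub 1)).sub hL).sub hL1
  have hlim2 := hlim.congr hconst
  have heq := tendsto_nhds_unique hlim2 tendsto_const_nhds
  intro n
  rw [hconst n, ← heq]
  ring
end

section
/- Let R be a commutative ring, k ≥ 1, and let M be a (k+1)×(k+1) matrix over R. Then det(M) · det(M with rows 1 and k+1 and columns 1 and k+1 deleted) = det(M with row k+1 and column k+1 deleted) · det(M with row 1 and column 1 deleted) − det(M with row 1 and column k+1 deleted) · det(M with row k+1 and column 1 deleted). (For k = 1 the determinant of the empty 0×0 matrix is 1.) -/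
open Matrix in
theorem jacobi_aux {n : Type*} [Fintype n] [DecidableEq n] {R : Type*} [CommRing R]
    (M : Matrix (Fin 2 ⊕ n) (Fin 2 ⊕ n) R) :
    M.det * (M.adjugate.toBlocks₁₁).det = M.det * (M.det * M.toBlocks₂₂.det) := by
  have h : M * fromBlocks M.adjugate.toBlocks₁₁ 0 M.adjugate.toBlocks₂₁ 1
      = fromBlocks (M.det • 1) M.toBlocks₁₂ 0 M.toBlocks₂₂ := by
    have h0 := mul_adjugate M
    rw [← fromBlocks_toBlocks M.adjugate] at h0
    nth_rewrite 1 [← fromBlocks_toBlocks M] at h0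
    nth_rewrite 1 [← fromBlocks_toBlocks M]
    rw [fromBlocks_multiply, ← fromBlocks_one, fromBlocks_smul, fromBlocks_inj] at h0
    rw [fromBlocks_multiply, h0.1, h0.2.2.1]
    simp
  have h2 := congrArg det h
  rw [det_mul, det_fromBlocks_zero₁₂, det_fromBlocks_zero₂₁, det_smul] at h2
  simp only [det_one, mul_one, Fintype.card_fin] at h2
  rw [h2]; ring

open Matrix in
theorem jacobi_two {n : Type*} [Fintype n] [DecidableEq n] {R : Type*} [CommRing R]
    (M : Matrix (Fin 2 ⊕ n) (Fin 2 ⊕ n) R) :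
    (M.adjugate.toBlocks₁₁).det = M.det * M.toBlocks₂₂.det := by
  let X := mvPolynomialX (Fin 2 ⊕ n) (Fin 2 ⊕ n) ℤ
  have hX : (X.adjugate.toBlocks₁₁).det = X.det * X.toBlocks₂₂.det :=
    mul_left_cancel₀ (det_mvPolynomialX_ne_zero _ ℤ) (jacobi_aux X)
  let f : MvPolynomial ((Fin 2 ⊕ n) × (Fin 2 ⊕ n)) ℤ →+* R :=
    MvPolynomial.eval₂Hom (Int.castRingHom R) (fun p => M p.1 p.2)
  have hM : f.mapMatrix X = M := by
    ext i j; simp [f, X]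
  have h := congrArg f hX
  rw [map_mul, RingHom.map_det, RingHom.map_det, RingHom.map_det, hM] at h
  have h1 : f.mapMatrix X.adjugate.toBlocks₁₁ = M.adjugate.toBlocks₁₁ := by
    rw [← hM, ← RingHom.map_adjugate]; rfl
  have h2 : f.mapMatrix X.toBlocks₂₂ = M.toBlocks₂₂ := by
    rw [← hM]; rfl
  rwa [h1, h2] at h

def endsMap (n : ℕ) : Fin 2 ⊕ Fin n → Fin (n + 2) :=
  Sum.elim ![0, Fin.last (n + 1)] (fun i => i.castSucc.succ)

theorem endsMap_bijective (n : ℕ) : Function.Bijective (endsMap n) := by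
  rw [Fintype.bijective_iff_injective_and_card]
  refine ⟨?_, by simp; omega⟩
  rintro (i | i) (j | j) h
  · fin_cases i <;> fin_cases j <;> simp_all [endsMap, Fin.ext_iff]
  · have := j.2
    fin_cases i <;> simp [endsMap, Fin.ext_iff] at h
    omega
  · have := i.2
    fin_cases j <;> simp [endsMap, Fin.ext_iff] at h
    omega
  · simpa [endsMap, Fin.ext_iff] using h


/-- the Desnanot–Jacobi identity. For a `(k+1)×(k+1)` matrix `M`
(with `k ≥ 1`, rows and columns indexed `0, …, k`, so that "row 1" is index `0`
and "row k+1" is index `k`):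
`det M · det M^{1,k+1}_{1,k+1} = det M^{k+1}_{k+1} · det M^1_1 - det M^{k+1}_1 · det M^1_{k+1}`,
where sub/superscripts denote deleted rows/columns. -/
theorem desnanot_jacobi
    (R : Type*) [CommRing R] (k : ℕ) (hk : 1 ≤ k)
    (M : Matrix (Fin (k + 1)) (Fin (k + 1)) R) :
    M.det *
      (M.submatrix (fun l : Fin (k - 1) => (⟨l.1 + 1, by have := l.2; omega⟩ : Fin (k + 1)))
                   (fun l : Fin (k - 1) => (⟨l.1 + 1, by have := l.2; omega⟩ : Fin (k + 1)))).det
    = (M.submatrix (fun l : Fin k => (⟨l.1, by have := l.2; omega⟩ : Fin (k + 1)))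
                   (fun l : Fin k => (⟨l.1, by have := l.2; omega⟩ : Fin (k + 1)))).det *
      (M.submatrix (fun l : Fin k => (⟨l.1 + 1, by have := l.2; omega⟩ : Fin (k + 1)))
                   (fun l : Fin k => (⟨l.1 + 1, by have := l.2; omega⟩ : Fin (k + 1)))).det
    - (M.submatrix (fun l : Fin k => (⟨l.1 + 1, by have := l.2; omega⟩ : Fin (k + 1)))
                   (fun l : Fin k => (⟨l.1, by have := l.2; omega⟩ : Fin (k + 1)))).det *
      (M.submatrix (fun l : Fin k => (⟨l.1, by have := l.2; omega⟩ : Fin (k + 1)))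
                   (fun l : Fin k => (⟨l.1 + 1, by have := l.2; omega⟩ : Fin (k + 1)))).det := by
  obtain ⟨n, rfl⟩ : ∃ n, k = n + 1 := ⟨k - 1, by omega⟩
  let e := Equiv.ofBijective _ (endsMap_bijective n)
  have h := jacobi_two (M.submatrix e e)
  rw [Matrix.det_submatrix_equiv_self, Matrix.adjugate_submatrix_equiv_self,
    Matrix.det_fin_two] at h
  have e0 : e (Sum.inl 0) = 0 := rfl
  have e1 : e (Sum.inl 1) = Fin.last (n + 1) := rfl
  simp only [Matrix.toBlocks₁₁, Matrix.of_apply, Matrix.submatrix_apply, e0, e1] at h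
  rw [Matrix.adjugate_fin_succ_eq_det_submatrix, Matrix.adjugate_fin_succ_eq_det_submatrix,
    Matrix.adjugate_fin_succ_eq_det_submatrix, Matrix.adjugate_fin_succ_eq_det_submatrix] at h
  have s0 : (Fin.succAbove (0 : Fin (n + 2))) =
      fun l : Fin (n + 1) => (⟨l.1 + 1, by have := l.2; omega⟩ : Fin (n + 1 + 1)) := by
    funext l; simp [Fin.ext_iff]
  have s1 : (Fin.succAbove (Fin.last (n + 1))) =
      fun l : Fin (n + 1) => (⟨l.1, by have := l.2; omega⟩ : Fin (n + 1 + 1)) := by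
    funext l; simp [Fin.ext_iff]
  rw [s0, s1] at h
  refine Eq.trans h.symm ?_
  have hs : ((-1 : R) ^ (n + 1)) * (-1) ^ (n + 1) = 1 := by
    rw [← mul_pow]; simp
  simp only [Fin.val_zero, Fin.val_last, pow_add, pow_zero, zero_add, add_zero, one_mul]
  simp only [pow_add] at hs
  linear_combination
    ((M.submatrix (fun l : Fin (n + 1) => (⟨l.1, by have := l.2; omega⟩ : Fin (n + 1 + 1)))
        (fun l : Fin (n + 1) => (⟨l.1, by have := l.2; omega⟩ : Fin (n + 1 + 1)))).det *
      (M.submatrix (fun l : Fin (n + 1) => (⟨l.1 + 1, by have := l.2; omega⟩ : Fin (n + 1 + 1)))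
        (fun l : Fin (n + 1) => (⟨l.1 + 1, by have := l.2; omega⟩ : Fin (n + 1 + 1)))).det
    - (M.submatrix (fun l : Fin (n + 1) => (⟨l.1 + 1, by have := l.2; omega⟩ : Fin (n + 1 + 1)))
        (fun l : Fin (n + 1) => (⟨l.1, by have := l.2; omega⟩ : Fin (n + 1 + 1)))).det *
      (M.submatrix (fun l : Fin (n + 1) => (⟨l.1, by have := l.2; omega⟩ : Fin (n + 1 + 1)))
        (fun l : Fin (n + 1) => (⟨l.1 + 1, by have := l.2; omega⟩ : Fin (n + 1 + 1)))).det) * hs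
end

section
/- Fix n ≥ 1 and let K be the field of rational functions in n² variables a_{i,j} (1 ≤ i,j ≤ n), i.e. the fraction field of the polynomial ring ℚ[a_{i,j}]. Define T_{i,j,k} ∈ K for i,j ∈ ℤ and 0 ≤ k ≤ n by: T_{ℓ,m,0} = 1 for all ℓ,m with ℓ+m ≡ n (mod 2); T_{i,j,1} = a_{(j−i+n+1)/2, (i+j+n+1)/2} for i+j ≡ n+1 (mod 2) and |i|+|j| ≤ n−1, and T_{i,j,1} = 1 for i+j ≡ n+1 (mod 2) and |i|+|j| > n−1; and the recursion T_{i,j,k+1} = (T_{i,j+1,k}·T_{i,j−1,k} − T_{i+1,j,k}·T_{i−1,j,k}) / T_{i,j,k−1} for k ≥ 1. Then T_{0,0,n} = det((a_{i,j})_{1≤i,j≤n}). -/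
/-- The field of rational functions in the `n²` variables `a_{i,j}`. -/
abbrev DodgsonField (n : ℕ) := FractionRing (MvPolynomial (Fin n × Fin n) ℚ)

/-- The variable `a_{p+1,q+1}` (`p q : Fin n` being the 0-based indices) viewed in the
field of rational functions. -/
noncomputable def dodgsonVar (n : ℕ) (p q : Fin n) : DodgsonField n :=
  algebraMap (MvPolynomial (Fin n × Fin n) ℚ) (DodgsonField n) (MvPolynomial.X (p, q))

/-- Desnanot–Jacobi identity for an invertible matrix over a field. -/
theorem desnanot_jacobi_aux {K : Type*} [Field K] (k : ℕ)
    (M : Matrix (Fin (k + 2)) (Fin (k + 2)) K) (hM : M.det ≠ 0) :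
    M.det * (M.submatrix (fun i : Fin k => i.castSucc.succ) (fun i : Fin k => i.castSucc.succ)).det
      = (M.submatrix Fin.succ Fin.succ).det * (M.submatrix Fin.castSucc Fin.castSucc).det
        - (M.submatrix Fin.castSucc Fin.succ).det * (M.submatrix Fin.succ Fin.castSucc).det := by
  classical
  have hl0 : Fin.last (k + 1) ≠ 0 := by simp [Fin.ext_iff]
  set B : Matrix (Fin (k + 2)) (Fin (k + 2)) K := Matrix.of fun i j =>
    if j = 0 then M.adjugate i 0 else if j = Fin.last (k + 1) then M.adjugate i (Fin.last (k + 1))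
    else if i = j then 1 else 0 with hB
  have hMadj : ∀ i j, ∑ l, M i l * M.adjugate l j = if i = j then M.det else 0 := by
    intro i j
    have := congrFun (congrFun (Matrix.mul_adjugate M) i) j
    rw [Matrix.mul_apply] at this
    rw [this]
    simp [Matrix.smul_apply, Matrix.one_apply]
  have hMB : ∀ i j, (M * B) i j = if j = 0 then (if i = 0 then M.det else 0)
      else if j = Fin.last (k + 1) then (if i = Fin.last (k + 1) then M.det else 0)
      else M i j := by
    intro i j
    rw [Matrix.mul_apply]
    by_cases h0 : j = 0
    · simp [hB, h0, hMadj]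
    · by_cases hl : j = Fin.last (k + 1)
      · simp [hB, hl, hMadj, hl0]
      · simp [hB, h0, hl]
  have hdMB : (M * B).det = M.det * (M.det *
      (M.submatrix (fun i : Fin k => i.castSucc.succ) (fun i : Fin k => i.castSucc.succ)).det) := by
    rw [Matrix.det_succ_column_zero, Finset.sum_eq_single 0]
    · rw [hMB, Matrix.det_succ_column _ (Fin.last k), Finset.sum_eq_single (Fin.last k)]
      · have e : ((M * B).submatrix (Fin.succAbove 0) Fin.succ).submatrix
            (Fin.last k).succAbove (Fin.last k).succAbove =
            M.submatrix (fun i : Fin k => i.castSucc.succ) (fun i : Fin k => i.castSucc.succ) := by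
          ext i j
          have : j.castSucc.succ ≠ Fin.last (k + 1) := by
            have := j.2
            simp only [ne_eq, Fin.ext_iff, Fin.val_succ, Fin.val_castSucc, Fin.val_last]; omega
          simp only [Matrix.submatrix_apply, Fin.succAbove_zero, Fin.succAbove_last, hMB]
          rw [if_neg (Fin.succ_ne_zero _), if_neg this]
        rw [e]
        simp [hMB, ← two_mul, pow_mul, hl0]
      · intro b _ hb
        have : b.succ ≠ Fin.last (k + 1) := by
          intro h; exact hb (Fin.succ_injective _ (by simpa using h))
        simp [hMB, hb, hl0]
      · simp
    · intro b _ hb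
      simp [hMB, hb]
    · simp
  have hdB : B.det = M.adjugate 0 0 * M.adjugate (Fin.last (k + 1)) (Fin.last (k + 1))
      - M.adjugate 0 (Fin.last (k + 1)) * M.adjugate (Fin.last (k + 1)) 0 := by
    have h1 : (B.submatrix Fin.succ Fin.succ).det
        = M.adjugate (Fin.last (k + 1)) (Fin.last (k + 1)) := by
      rw [Matrix.det_succ_row _ (Fin.last k), Finset.sum_eq_single (Fin.last k)]
      · have e : (B.submatrix Fin.succ Fin.succ).submatrix
            (Fin.last k).succAbove (Fin.last k).succAbove = 1 := by
          ext i j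
          have : j.castSucc.succ ≠ Fin.last (k + 1) := by
            have := j.2
            simp only [ne_eq, Fin.ext_iff, Fin.val_succ, Fin.val_castSucc, Fin.val_last]; omega
          simp only [Matrix.submatrix_apply, Fin.succAbove_last, hB, Matrix.of_apply]
          rw [if_neg (Fin.succ_ne_zero _), if_neg this]
          simp [Matrix.one_apply]
        rw [e]
        simp [hB, ← two_mul, pow_mul, hl0]
      · intro b _ hb
        have h2 : b.succ ≠ Fin.last (k + 1) := by
          intro h; exact hb (Fin.succ_injective _ (by simpa using h))
        simp [hB, hb, h2.symm]
      · simp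
    have h2 : (B.submatrix Fin.succ Fin.castSucc).det
        = (-1) ^ k * M.adjugate (Fin.last (k + 1)) 0 := by
      rw [Matrix.det_succ_row _ (Fin.last k), Finset.sum_eq_single 0]
      · have e : (B.submatrix Fin.succ Fin.castSucc).submatrix
            (Fin.last k).succAbove (Fin.succAbove 0) = 1 := by
          ext i j
          have : j.succ.castSucc ≠ Fin.last (k + 1) := Fin.castSucc_ne_last _
          have h3 : j.succ.castSucc ≠ 0 := by simp [Fin.ext_iff]
          simp only [Matrix.submatrix_apply, Fin.succAbove_last, Fin.succAbove_zero, hB,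
            Matrix.of_apply]
          rw [if_neg h3, if_neg this]
          simp [Matrix.one_apply, Fin.ext_iff]
        rw [e]
        simp [hB]
      · intro b _ hb
        have h3 : b.castSucc ≠ 0 := by
            intro h
            apply hb
            apply Fin.ext
            simpa using congrArg Fin.val h
        have h4 : (Fin.last k).succ ≠ b.castSucc := by
          have := b.2
          simp only [ne_eq, Fin.ext_iff, Fin.val_succ, Fin.val_castSucc, Fin.val_last]; omega
        have h5 : B (Fin.last k).succ b.castSucc = 0 := by
          simp only [hB, Matrix.of_apply]
          rw [if_neg h3, if_neg (Fin.castSucc_ne_last _), if_neg h4]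
        simp only [Matrix.submatrix_apply, h5]
        simp
      · simp
    rw [Matrix.det_succ_row_zero, Finset.sum_eq_add (0 : Fin (k + 2)) (Fin.last (k + 1)) hl0.symm]
    · rw [Fin.succAbove_last, Fin.succAbove_zero, h1, h2]
      have h3 : B 0 0 = M.adjugate 0 0 := by simp [hB]
      have h4 : B 0 (Fin.last (k + 1)) = M.adjugate 0 (Fin.last (k + 1)) := by simp [hB, hl0]
      rw [h3, h4]
      have h5 : ((-1 : K) ^ k) * (-1) ^ k = 1 := by rw [← mul_pow]; simp
      simp only [Fin.val_zero, Fin.val_last, pow_succ, pow_zero]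
      linear_combination (-M.adjugate 0 (Fin.last (k + 1)) * M.adjugate (Fin.last (k + 1)) 0) * h5
    · intro c _ hc
      simp [hB, hc.1, hc.2, Ne.symm hc.1]
    · simp
    · simp
  rw [Matrix.det_mul, hdB] at hdMB
  have := mul_left_cancel₀ hM hdMB
  rw [← this]
  simp only [Matrix.adjugate_fin_succ_eq_det_submatrix, Fin.succAbove_zero, Fin.succAbove_last]
  have h5 : ((-1 : K) ^ k) * (-1) ^ k = 1 := by rw [← mul_pow]; simp
  simp only [Fin.val_zero, Fin.val_last, pow_succ, pow_zero, pow_add, add_zero, zero_add]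
  linear_combination ((M.submatrix Fin.succ Fin.succ).det
    * (M.submatrix Fin.castSucc Fin.castSucc).det
        - (M.submatrix Fin.castSucc Fin.succ).det * (M.submatrix Fin.succ Fin.castSucc).det) * h5

/-- Entries of the generic matrix, indexed by natural numbers. -/
noncomputable def dodgsonEntry (n p q : ℕ) : MvPolynomial (Fin n × Fin n) ℚ :=
  if h : p < n ∧ q < n then MvPolynomial.X (⟨p, h.1⟩, ⟨q, h.2⟩) else 0

/-- The contiguous `k × k` block with top left corner `(p, q)`. -/
noncomputable def dodgsonBlock (n p q k : ℕ) : Matrix (Fin k) (Fin k) (DodgsonField n) :=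
  Matrix.of fun i j => algebraMap (MvPolynomial (Fin n × Fin n) ℚ) (DodgsonField n)
    (dodgsonEntry n (p + i) (q + j))

theorem dodgsonBlock_det_ne_zero (n p q k : ℕ) (hp : p + k ≤ n) (hq : q + k ≤ n) :
    (dodgsonBlock n p q k).det ≠ 0 := by
  have e : dodgsonBlock n p q k =
      (algebraMap (MvPolynomial (Fin n × Fin n) ℚ) (DodgsonField n)).mapMatrix
        (Matrix.of fun i j : Fin k => dodgsonEntry n (p + i) (q + j)) := by
    ext i j; rfl
  rw [e, ← RingHom.map_det]
  intro h
  have h2 := (IsFractionRing.injective (MvPolynomial (Fin n × Fin n) ℚ) (DodgsonField n))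
    (h.trans (map_zero _).symm)
  have h3 := congrArg (MvPolynomial.eval
    (fun x : Fin n × Fin n => if (x.1 : ℕ) + q = x.2 + p then (1 : ℚ) else 0)) h2
  rw [RingHom.map_det, map_zero] at h3
  have e2 : (MvPolynomial.eval
    (fun x : Fin n × Fin n => if (x.1 : ℕ) + q = x.2 + p then (1 : ℚ) else 0)).mapMatrix
      (Matrix.of fun i j : Fin k => dodgsonEntry n (p + i) (q + j)) = 1 := by
    ext i j
    have hh : p + (i : ℕ) < n ∧ q + (j : ℕ) < n := by omega
    simp only [RingHom.mapMatrix_apply, Matrix.map_apply, Matrix.of_apply, dodgsonEntry, dif_pos hh,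
      MvPolynomial.eval_X, Matrix.one_apply, Fin.ext_iff]
    congr 1
    apply propext
    omega
  rw [e2, Matrix.det_one] at h3
  exact one_ne_zero h3

theorem dodgsonBlock_rec (n p q k : ℕ) (hp : p + (k + 2) ≤ n) (hq : q + (k + 2) ≤ n) :
    (dodgsonBlock n p q (k + 2)).det * (dodgsonBlock n (p + 1) (q + 1) k).det =
      (dodgsonBlock n (p + 1) (q + 1) (k + 1)).det * (dodgsonBlock n p q (k + 1)).det
      - (dodgsonBlock n p (q + 1) (k + 1)).det * (dodgsonBlock n (p + 1) q (k + 1)).det := by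
  have h := desnanot_jacobi_aux k _ (dodgsonBlock_det_ne_zero n p q (k + 2) hp hq)
  convert h using 3 <;> (try congr 1) <;> ext i j <;>
    simp [dodgsonBlock, add_comm, add_left_comm]

theorem dodgson_condensation
    (n : ℕ) (hn : 1 ≤ n)
    (T : ℤ → ℤ → ℕ → DodgsonField n)
    (h0 : ∀ i j : ℤ, (i + j - (n : ℤ)) % 2 = 0 → T i j 0 = 1)
    (h1 : ∀ p q : Fin n,
      T ((q : ℤ) - (p : ℤ)) ((p : ℤ) + (q : ℤ) + 1 - (n : ℤ)) 1 = dodgsonVar n p q)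
    (h1' : ∀ i j : ℤ, (i + j - ((n : ℤ) + 1)) % 2 = 0 → (n : ℤ) - 1 < |i| + |j| →
      T i j 1 = 1)
    (hrec : ∀ (i j : ℤ) (k : ℕ), 1 ≤ k → k + 1 ≤ n →
      T i j (k + 1) =
        (T i (j + 1) k * T i (j - 1) k - T (i + 1) j k * T (i - 1) j k) / T i j (k - 1)) :
    T 0 0 n = Matrix.det (Matrix.of fun p q : Fin n => dodgsonVar n p q) := by
  have key : ∀ k p q : ℕ, p + k ≤ n → q + k ≤ n → ∀ i j : ℤ, i = q - p → j = p + q + k - n →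
      T i j k = (dodgsonBlock n p q k).det := by
    intro k
    induction k using Nat.strong_induction_on with
    | _ k ih =>
      intro p q hp hq i j hi hj
      match k, ih, hp, hq, hj with
      | 0, _, _, _, hj =>
        rw [h0 _ _ (by subst hi hj; push_cast; omega)]
        simp
      | 1, _, hp, hq, hj =>
        have := h1 ⟨p, by omega⟩ ⟨q, by omega⟩
        subst hi hj
        simp only [Nat.cast_one]
        rw [this]
        have hh : p < n ∧ q < n := by omega
        simp [dodgsonBlock, dodgsonEntry, dodgsonVar, hh]
      | k + 2, ih, hp, hq, hj =>
        push_cast at hj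
        rw [hrec i j (k + 1) (by omega) (by omega), Nat.add_sub_cancel,
          ih k (by omega) (p + 1) (q + 1) (by omega) (by omega) i j
            (by push_cast; omega) (by push_cast; omega),
          ih (k + 1) (by omega) (p + 1) (q + 1) (by omega) (by omega) i (j + 1)
            (by push_cast; omega) (by push_cast; omega),
          ih (k + 1) (by omega) p q (by omega) (by omega) i (j - 1)
            (by push_cast; omega) (by push_cast; omega),
          ih (k + 1) (by omega) p (q + 1) (by omega) (by omega) (i + 1) j
            (by push_cast; omega) (by push_cast; omega),
          ih (k + 1) (by omega) (p + 1) q (by omega) (by omega) (i - 1) j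
            (by push_cast; omega) (by push_cast; omega),
          ← dodgsonBlock_rec n p q k hp hq, mul_div_assoc, div_self, mul_one]
        exact dodgsonBlock_det_ne_zero n _ _ _ (by omega) (by omega)
  rw [key n 0 0 (by omega) (by omega) 0 0 (by simp) (by simp)]
  congr 1
  ext i j
  simp [dodgsonBlock, dodgsonEntry, dodgsonVar]
end

section
/- Let K be a field and let u, a, b, c, v, x ∈ K with b, c, x all nonzero. Define the 2×2 matrices D(u,a,b) = [[1, 0], [u/b, a/b]] and U(b,c,v) = [[b/c, v/c], [0, 1]]. Then D(u,a,b) · U(b,c,v) = U(a,x,v) · D(u,x,c) if and only if b·x = a·c + u·v. -/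
/-- the exchange relation for the elementary transfer matrices
`D(u,a,b) = [[1,0],[u/b,a/b]]` and `U(b,c,v) = [[b/c,v/c],[0,1]]`:
`D(u,a,b) U(b,c,v) = U(a,x,v) D(u,x,c)` if and only if `bx = ac + uv`. -/
theorem DU_exchange_iff_octahedron
    (K : Type*) [Field K] (u a b c v x : K)
    (hb : b ≠ 0) (hc : c ≠ 0) (hx : x ≠ 0) :
    (!![1, 0; u / b, a / b] : Matrix (Fin 2) (Fin 2) K) * !![b / c, v / c; 0, 1]
      = (!![a / x, v / x; 0, 1] : Matrix (Fin 2) (Fin 2) K) * !![1, 0; u / c, x / c]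
    ↔ b * x = a * c + u * v := by
  have e1 : b / c = a / x + v / x * (u / c) ↔ b * x = a * c + u * v := by
    have h : a / x + v / x * (u / c) = (a * c + u * v) / (x * c) := by
      field_simp
    have h' : b / c = (b * x) / (x * c) := by
      field_simp
    rw [h, h', div_left_inj' (mul_ne_zero hx hc)]
  have e2 : v / c = v / x * (x / c) := by
    field_simp
  have e3 : u / b * (b / c) = u / c := by
    field_simp
  have e4 : b * x = a * c + u * v → u / b * (v / c) + a / b = x / c := by
    intro h
    have h1 : u / b * (v / c) + a / b = (a * c + u * v) / (b * c) := by
      field_simp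
      ring
    rw [h1, ← h]
    field_simp
  rw [Matrix.mul_fin_two, Matrix.mul_fin_two]
  constructor
  · intro h
    have h00 := congrFun (congrFun h 0) 0
    simp at h00
    exact e1.mp h00
  · intro h
    have h1 := e1.mpr h
    have h4 := e4 h
    ext i j
    fin_cases i <;> fin_cases j
    · simpa using h1
    · simpa using e2
    · simpa using e3
    · simpa using h4
end

section
/- Let K be the fraction field of the polynomial ring ℚ[x_{i,j} : (i,j) ∈ ℤ×ℤ] in countably many variables indexed by ℤ². Define T_{i,j,k} ∈ K for all i,j ∈ ℤ and k ∈ ℕ with i+j+k even by: T_{i,j,0} = 1 for i+j even; T_{i,j,1} = x_{i,j} for i+j odd; and the recursion T_{i,j,k+1} = (T_{i,j+1,k}·T_{i,j−1,k} + T_{i+1,j,k}·T_{i−1,j,k}) / T_{i,j,k−1} for k ≥ 1. Then for every i, j, k, the element T_{i,j,k} is a Laurent polynomial in the variables x_{i,j} with nonnegative integer coefficients, i.e. T_{i,j,k} lies in the subsemiring of K generated by the variables x_{i,j} and their inverses x_{i,j}^{-1}. -/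
/-- The field of rational functions in the variables `x_{i,j}`, `(i,j) ∈ ℤ×ℤ`. -/
abbrev TSystemField := FractionRing (MvPolynomial (ℤ × ℤ) ℚ)

/-- The variable `x_{i,j}` viewed in the field of rational functions. -/
noncomputable def tVar (i j : ℤ) : TSystemField :=
  algebraMap (MvPolynomial (ℤ × ℤ) ℚ) TSystemField (MvPolynomial.X (i, j))


/-! ### Summation over functions with prescribed local ranges -/

namespace TSys

/-- Functions `f` with `f i ∈ t i` on `S` and `f = d` off `S`. -/
noncomputable def PF (S : Finset (ℤ × ℤ)) (t : ℤ × ℤ → Finset ℤ) (d : ℤ × ℤ → ℤ) :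
    Finset (ℤ × ℤ → ℤ) := by
  classical
  exact (S.pi t).image (fun f i => if h : i ∈ S then f i h else d i)

lemma mem_PF {S : Finset (ℤ × ℤ)} {t : ℤ × ℤ → Finset ℤ} {d f : ℤ × ℤ → ℤ} :
    f ∈ PF S t d ↔ (∀ i ∈ S, f i ∈ t i) ∧ ∀ i, i ∉ S → f i = d i := by
  classical
  unfold PF
  simp only [Finset.mem_image, Finset.mem_pi]
  constructor
  · rintro ⟨g, hg, rfl⟩
    refine ⟨fun i hi => ?_, fun i hi => ?_⟩
    · simpa [hi] using hg i hi
    · simp [hi]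
  · rintro ⟨h1, h2⟩
    refine ⟨fun i _ => f i, fun i hi => h1 i hi, ?_⟩
    funext i
    by_cases hi : i ∈ S
    · simp [hi]
    · simp [hi, h2 i hi]

lemma sum_PF {K : Type*} [CommRing K] (S : Finset (ℤ × ℤ)) (t : ℤ × ℤ → Finset ℤ)
    (d : ℤ × ℤ → ℤ) (g : ℤ × ℤ → ℤ → K) :
    ∑ f ∈ PF S t d, ∏ i ∈ S, g i (f i) = ∏ i ∈ S, ∑ v ∈ t i, g i v := by
  classical
  rw [Finset.prod_sum]
  unfold PF
  rw [Finset.sum_image]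
  · refine Finset.sum_congr rfl fun f _ => ?_
    rw [← Finset.prod_attach]
    refine Finset.prod_congr rfl fun i _ => ?_
    simp
  · intro f _ f' _ h
    funext i hi
    have := congrFun h i
    simpa [hi] using this

/-! ### Corner sum matrices -/

/-- Corner sums of the identity matrix. -/
def dd (p : ℤ × ℤ) : ℤ := max 0 (min p.1 p.2)

/-- Mixed second difference. -/
def MM (s : ℤ × ℤ → ℤ) (p : ℤ × ℤ) : ℤ :=
  s (p.1, p.2) + s (p.1 - 1, p.2 - 1) - s (p.1 - 1, p.2) - s (p.1, p.2 - 1)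

/-- The box `[1,n]²`. -/
noncomputable def S (n : ℤ) : Finset (ℤ × ℤ) := Finset.Icc 1 n ×ˢ Finset.Icc 1 n

/-- The box `[0,n-1]²`. -/
noncomputable def S0 (n : ℤ) : Finset (ℤ × ℤ) := Finset.Icc 0 (n - 1) ×ˢ Finset.Icc 0 (n - 1)

lemma mem_S {n i j : ℤ} : (i, j) ∈ S n ↔ (1 ≤ i ∧ i ≤ n) ∧ (1 ≤ j ∧ j ≤ n) := by
  simp [S]

lemma mem_S0 {n i j : ℤ} : (i, j) ∈ S0 n ↔ (0 ≤ i ∧ i ≤ n - 1) ∧ (0 ≤ j ∧ j ≤ n - 1) := by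
  simp [S0]

noncomputable def upI (A : ℤ × ℤ → ℤ) (p : ℤ × ℤ) : Finset ℤ :=
  Finset.Icc (max (A (p.1 - 1, p.2)) (A (p.1, p.2 - 1)))
    (min (A (p.1, p.2)) (A (p.1 - 1, p.2 - 1) + 1))

noncomputable def dnI (A : ℤ × ℤ → ℤ) (p : ℤ × ℤ) : Finset ℤ :=
  Finset.Icc (max (A (p.1, p.2)) (A (p.1 + 1, p.2 + 1) - 1))
    (min (A (p.1 + 1, p.2)) (A (p.1, p.2 + 1)))

noncomputable def Up (n : ℤ) (A : ℤ × ℤ → ℤ) := PF (S n) (upI A) dd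
noncomputable def Down (n : ℤ) (A : ℤ × ℤ → ℤ) := PF (S0 n) (dnI A) dd

/-- Increments are in `{0,1}`. -/
def Incr (A : ℤ × ℤ → ℤ) : Prop :=
  ∀ i j : ℤ, A (i - 1, j) ≤ A (i, j) ∧ A (i, j) ≤ A (i - 1, j) + 1 ∧
    A (i, j - 1) ≤ A (i, j) ∧ A (i, j) ≤ A (i, j - 1) + 1

def IsASM (n : ℤ) (A : ℤ × ℤ → ℤ) : Prop :=
  (∀ i j : ℤ, (i, j) ∉ S (n - 1) → A (i, j) = dd (i, j)) ∧ Incr A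

noncomputable def ASM (n : ℤ) : Finset (ℤ × ℤ → ℤ) := by
  classical
  exact (PF (S (n - 1)) (fun p => Finset.Icc 0 p.1) dd).filter Incr

lemma bound_aux (A : ℤ × ℤ → ℤ) (h : Incr A) (j : ℤ) (h0 : A (0, j) = 0) (m : ℕ) :
    0 ≤ A ((m : ℤ), j) ∧ A ((m : ℤ), j) ≤ m := by
  induction m with
  | zero => simp [h0]
  | succ m ih =>
    have := h ((m : ℤ) + 1) j
    rw [add_sub_cancel_right] at this
    push_cast
    omega

lemma mem_ASM {n : ℤ} {A : ℤ × ℤ → ℤ} : A ∈ ASM n ↔ IsASM n A := by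
  classical
  unfold ASM IsASM
  rw [Finset.mem_filter, mem_PF]
  constructor
  · rintro ⟨⟨_, h2⟩, h3⟩
    exact ⟨fun i j hij => h2 _ hij, h3⟩
  · rintro ⟨h1, h2⟩
    refine ⟨⟨?_, fun p hp => h1 p.1 p.2 hp⟩, h2⟩
    rintro ⟨i, j⟩ hij
    rw [mem_S] at hij
    have h0 : A (0, j) = 0 := by
      rw [h1 0 j (by rw [mem_S]; omega)]
      simp [dd]
    obtain ⟨m, rfl⟩ := Int.eq_ofNat_of_zero_le (show 0 ≤ i by omega)
    simpa using bound_aux A h2 j h0 m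

/-- The compatibility relation. -/
def Rel (A C : ℤ × ℤ → ℤ) : Prop :=
  ∀ i j : ℤ, A (i - 1, j) ≤ C (i, j) ∧ A (i, j - 1) ≤ C (i, j) ∧
    C (i, j) ≤ A (i, j) ∧ C (i, j) ≤ A (i - 1, j - 1) + 1

lemma rel_of_up {n : ℤ} {A C : ℤ × ℤ → ℤ} (hA : IsASM n A) (hC : C ∈ Up n A) : Rel A C := by
  intro i j
  unfold Up at hC
  rw [mem_PF] at hC
  by_cases h : (i, j) ∈ S n
  · have := hC.1 _ h
    simp only [upI, Finset.mem_Icc] at this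
    omega
  · rw [hC.2 _ h]
    rw [mem_S] at h
    rw [hA.1 (i - 1) j (by rw [mem_S]; omega), hA.1 i (j - 1) (by rw [mem_S]; omega),
      hA.1 i j (by rw [mem_S]; omega), hA.1 (i - 1) (j - 1) (by rw [mem_S]; omega)]
    simp only [dd]
    omega

lemma rel_of_down {n : ℤ} {A C : ℤ × ℤ → ℤ} (hC : IsASM (n + 1) C) (hA : A ∈ Down (n + 1) C) :
    Rel A C := by
  have key : ∀ i j : ℤ, C (i, j) ≤ A (i, j) ∧ C (i + 1, j + 1) - 1 ≤ A (i, j) ∧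
      A (i, j) ≤ C (i + 1, j) ∧ A (i, j) ≤ C (i, j + 1) := by
    intro i j
    unfold Down at hA
    rw [mem_PF] at hA
    by_cases h : (i, j) ∈ S0 (n + 1)
    · have := hA.1 _ h
      simp only [dnI, Finset.mem_Icc] at this
      omega
    · rw [hA.2 _ h]
      rw [mem_S0] at h
      rw [hC.1 (i + 1) j (by rw [mem_S]; omega), hC.1 i (j + 1) (by rw [mem_S]; omega),
        hC.1 i j (by rw [mem_S]; omega), hC.1 (i + 1) (j + 1) (by rw [mem_S]; omega)]
      simp only [dd]
      omega
  intro i j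
  have h1 := key i j
  have h2 := key (i - 1) j
  have h3 := key i (j - 1)
  have h4 := key (i - 1) (j - 1)
  simp only [sub_add_cancel] at h1 h2 h3 h4
  omega

lemma Rel.incr_left {A C : ℤ × ℤ → ℤ} (h : Rel A C) : Incr A := by
  intro i j
  have h1 := h i j
  have h2 := h (i + 1) j
  have h3 := h i (j + 1)
  have h4 := h (i + 1) (j + 1)
  simp only [add_sub_cancel_right] at h1 h2 h3 h4
  omega

lemma Rel.incr_right {A C : ℤ × ℤ → ℤ} (h : Rel A C) : Incr C := by
  intro i j
  have h1 := h i j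
  have h2 := h (i - 1) j
  have h3 := h i (j - 1)
  omega

lemma swap {n : ℤ} (A C : ℤ × ℤ → ℤ) :
    A ∈ ASM n ∧ C ∈ Up n A ↔ A ∈ Down (n + 1) C ∧ C ∈ ASM (n + 1) := by
  rw [mem_ASM, mem_ASM]
  constructor
  · rintro ⟨hA, hC⟩
    have hr := rel_of_up hA hC
    refine ⟨?_, ?_, hr.incr_right⟩
    · unfold Down
      rw [mem_PF]
      constructor
      · rintro ⟨i, j⟩ _
        have h1 := hr i j
        have h2 := hr (i + 1) j
        have h3 := hr i (j + 1)
        have h4 := hr (i + 1) (j + 1)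
        simp only [add_sub_cancel_right] at h1 h2 h3 h4
        simp only [dnI, Finset.mem_Icc]
        omega
      · rintro ⟨i, j⟩ h
        apply hA.1
        rw [mem_S0] at h
        rw [mem_S]
        omega
    · intro i j h
      rw [add_sub_cancel_right] at h
      unfold Up at hC
      rw [mem_PF] at hC
      exact hC.2 _ h
  · rintro ⟨hA, hC⟩
    have hr := rel_of_down hC hA
    refine ⟨⟨?_, hr.incr_left⟩, ?_⟩
    · intro i j h
      by_cases h' : (i, j) ∈ S0 (n + 1)
      · rw [mem_S] at h
        rw [mem_S0] at h'
        have h1 := hr i j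
        have h2 := hr (i + 1) j
        have h3 := hr i (j + 1)
        have h4 := hr (i + 1) (j + 1)
        simp only [add_sub_cancel_right] at h1 h2 h3 h4
        have e1 := hC.1 i j
        have e2 := hC.1 (i + 1) j
        have e3 := hC.1 i (j + 1)
        have e4 := hC.1 (i + 1) (j + 1)
        rw [mem_S] at e1 e2 e3 e4
        simp only [dd] at *
        omega
      · unfold Down at hA
        rw [mem_PF] at hA
        exact hA.2 _ h'
    · unfold Up
      rw [mem_PF]
      constructor
      · rintro ⟨i, j⟩ _
        have h1 := hr i j
        simp only [upI, Finset.mem_Icc]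
        omega
      · rintro ⟨i, j⟩ h
        exact hC.1 i j (by rwa [add_sub_cancel_right])

/-! ### The local identity -/

lemma cell {K : Type*} [Field K] (P Q : K) (hP : P ≠ 0) (hPQ : P + Q ≠ 0)
    (D s t U : ℤ) (h1 : D ≤ s) (h2 : s ≤ D + 1) (h3 : D ≤ t) (h4 : t ≤ D + 1)
    (h5 : s ≤ U) (h6 : U ≤ s + 1) (h7 : t ≤ U) (h8 : U ≤ t + 1) :
    (∑ c ∈ Finset.Icc (max s t) (min U (D + 1)), (P / Q) ^ (c - U)) * P ^ (U + D - s - t) =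
      (P + Q) ^ (U + D - s - t) *
        ∑ b ∈ Finset.Icc (max D (U - 1)) (min s t), (P / Q) ^ (D - b) := by
  have hI : ∀ a : ℤ, Finset.Icc a (a + 1) = {a, a + 1} := by
    intro a; ext; simp; omega
  have hone : ∀ (lo hi : ℤ) (f : ℤ → K), lo = hi → ∑ c ∈ Finset.Icc lo hi, f c = f lo := by
    rintro lo _ f rfl; simp
  have htwo : ∀ (lo hi : ℤ) (f : ℤ → K), hi = lo + 1 →
      ∑ c ∈ Finset.Icc lo hi, f c = f lo + f (lo + 1) := by
    rintro lo _ f rfl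
    rw [hI, Finset.sum_pair (by omega)]
  have ha : U + D - s - t = 0 ∨ U + D - s - t = 1 ∨ U + D - s - t = -1 := by omega
  rcases ha with ha | ha | ha
  · rw [hone _ _ _ (by omega), hone _ _ _ (by omega), ha]
    rw [show max s t - U = D - max D (U - 1) by omega]
    simp
  · rw [htwo _ _ _ (by omega), hone _ _ _ (by omega), ha]
    rw [show max s t - U = -1 by omega, show max s t + 1 - U = 0 by omega,
      show D - max D (U - 1) = 0 by omega]
    simp
    field_simp
    ring
  · rw [hone _ _ _ (by omega), htwo _ _ _ (by omega), ha]
    rw [show max s t - U = 0 by omega, show D - (max D (U - 1) + 1) = -1 by omega,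
      show D - max D (U - 1) = 0 by omega]
    simp
    field_simp

/-! ### Products of monomials -/

section prods

variable {K : Type*} [Field K]

/-- The shift lemma. -/
lemma shift (x : ℤ × ℤ → K) (g : ℤ × ℤ → ℤ) (n a b : ℤ) (ha : a = 0 ∨ a = 1)
    (hb : b = 0 ∨ b = 1) (hg : ∀ i j, (i, j) ∉ S n → g (i, j) = 0) :
    ∏ p ∈ S (n + 1), x p ^ g (p.1 - a, p.2 - b) = ∏ p ∈ S n, x (p.1 + a, p.2 + b) ^ g p := by
  symm
  refine Finset.prod_bij_ne_one (fun p _ _ => (p.1 + a, p.2 + b)) ?_ ?_ ?_ ?_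
  · rintro ⟨i, j⟩ h _
    rw [mem_S] at h ⊢
    omega
  · rintro ⟨i, j⟩ _ _ ⟨i', j'⟩ _ _ h
    simpa using h
  · rintro ⟨i, j⟩ h h1
    have : (i - a, j - b) ∈ S n := by
      by_contra hc
      apply h1
      simp [hg _ _ hc]
    refine ⟨(i - a, j - b), this, ?_, ?_⟩
    · simpa using h1
    · simp
  · rintro ⟨i, j⟩ _ _
    simp

/-- The cross ratio. -/
noncomputable def w (x : ℤ × ℤ → K) (p : ℤ × ℤ) : K :=
  (x (p.1, p.2) * x (p.1 + 1, p.2 + 1)) / (x (p.1 + 1, p.2) * x (p.1, p.2 + 1))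

lemma prod_MM (x : ℤ × ℤ → K) (hx : ∀ p, x p ≠ 0) (g : ℤ × ℤ → ℤ) (n : ℤ)
    (hg : ∀ i j, (i, j) ∉ S n → g (i, j) = 0) :
    ∏ p ∈ S (n + 1), x p ^ MM g p = ∏ p ∈ S n, w x p ^ g p := by
  have e1 := shift x g n 0 0 (by simp) (by simp) hg
  have e2 := shift x g n 1 1 (by simp) (by simp) hg
  have e3 := shift x g n 1 0 (by simp) (by simp) hg
  have e4 := shift x g n 0 1 (by simp) (by simp) hg
  have hL : ∏ p ∈ S (n + 1), x p ^ MM g p =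
      ((∏ p ∈ S (n + 1), x p ^ g (p.1 - 0, p.2 - 0)) *
        (∏ p ∈ S (n + 1), x p ^ g (p.1 - 1, p.2 - 1))) /
      ((∏ p ∈ S (n + 1), x p ^ g (p.1 - 1, p.2 - 0)) *
        (∏ p ∈ S (n + 1), x p ^ g (p.1 - 0, p.2 - 1))) := by
    rw [← Finset.prod_mul_distrib, ← Finset.prod_mul_distrib, ← Finset.prod_div_distrib]
    refine Finset.prod_congr rfl fun p _ => ?_
    simp only [MM, sub_zero]
    rw [zpow_sub₀ (hx p), zpow_sub₀ (hx p), zpow_add₀ (hx p), div_div]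
  rw [hL, e1, e2, e3, e4]
  rw [← Finset.prod_mul_distrib, ← Finset.prod_mul_distrib, ← Finset.prod_div_distrib]
  refine Finset.prod_congr rfl fun p _ => ?_
  simp only [w, add_zero, div_zpow, mul_zpow]

lemma MM_zero {n : ℤ} {A : ℤ × ℤ → ℤ} (hA : ∀ i j : ℤ, (i, j) ∉ S (n - 1) → A (i, j) = dd (i, j))
    (i j : ℤ) (h : (i, j) ∉ S n) : MM A (i, j) = if i = j ∧ 1 ≤ i then 1 else 0 := by
  rw [mem_S] at h
  simp only [MM]
  rw [hA (i - 1) j (by rw [mem_S]; omega), hA i (j - 1) (by rw [mem_S]; omega),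
      hA i j (by rw [mem_S]; omega), hA (i - 1) (j - 1) (by rw [mem_S]; omega)]
  simp only [dd]
  split_ifs <;> omega

/-- The product over the larger box only adds the corner. -/
lemma prod_corner (n : ℤ) (hn : 0 ≤ n) {A : ℤ × ℤ → ℤ}
    (hA : ∀ i j : ℤ, (i, j) ∉ S (n - 1) → A (i, j) = dd (i, j)) (x : ℤ × ℤ → K) :
    ∏ p ∈ S (n + 1), x p ^ MM A p = x (n + 1, n + 1) * ∏ p ∈ S n, x p ^ MM A p := by
  have hni : (n + 1, n + 1) ∉ S n := by rw [mem_S]; omega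
  have hsub : insert (n + 1, n + 1) (S n) ⊆ S (n + 1) := by
    rintro ⟨i, j⟩ h
    rw [Finset.mem_insert, mem_S, Prod.mk.injEq] at h
    rw [mem_S]
    omega
  rw [← Finset.prod_subset hsub, Finset.prod_insert hni]
  · rw [MM_zero hA _ _ hni, if_pos ⟨rfl, by omega⟩, zpow_one]
  · rintro ⟨i, j⟩ h h'
    rw [Finset.mem_insert, mem_S, Prod.mk.injEq] at h'
    rw [mem_S] at h
    rw [MM_zero hA _ _ (by rw [mem_S]; omega), if_neg (by omega), zpow_zero]

lemma prod_C (n : ℤ) (hn : 0 ≤ n) {A C : ℤ × ℤ → ℤ} (hA : IsASM n A) (hC : C ∈ Up n A)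
    (x : ℤ × ℤ → K) (hx : ∀ p, x p ≠ 0) :
    ∏ p ∈ S (n + 1), x p ^ MM C p =
      x (n + 1, n + 1) * ∏ p ∈ S n, (w x p ^ (C p - A p) * x p ^ MM A p) := by
  have h := prod_MM x hx (fun p => C p - A p) n (by
    intro i j hij
    unfold Up at hC
    rw [mem_PF] at hC
    rw [hC.2 _ hij, hA.1 i j (by rw [mem_S] at hij ⊢; omega), sub_self])
  rw [Finset.prod_mul_distrib, ← h, mul_left_comm, ← prod_corner n hn hA.1,
    ← Finset.prod_mul_distrib]
  refine Finset.prod_congr rfl fun p _ => ?_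
  rw [← zpow_add₀ (hx p)]
  congr 1
  simp only [MM]
  ring

lemma prod_B (n : ℤ) (hn : 1 ≤ n) {A B : ℤ × ℤ → ℤ} (hA : IsASM n A)
    (hB : ∀ i j : ℤ, (i, j) ∉ S (n - 2) → B (i, j) = dd (i, j))
    (x : ℤ × ℤ → K) (hx : ∀ p, x p ≠ 0) :
    ∏ p ∈ S (n - 1), (x (p.1 + 1, p.2 + 1) ^ MM B p)⁻¹ =
      x (n + 1, n + 1) * ∏ p ∈ S n, (w x p ^ (A (p.1 - 1, p.2 - 1) - B (p.1 - 1, p.2 - 1)) *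
        (x (p.1 + 1, p.2 + 1) ^ MM A p)⁻¹) := by
  have h := prod_MM x hx (fun p => A (p.1 - 1, p.2 - 1) - B (p.1 - 1, p.2 - 1)) n (by
    intro i j hij
    rw [mem_S] at hij
    rw [hB _ _ (by rw [mem_S]; omega), hA.1 _ _ (by rw [mem_S]; omega), sub_self])
  have hcB := prod_corner (K := K) (n - 1) (by omega) (A := B)
    (by intro i j hij; exact hB i j (by rw [mem_S] at hij ⊢; omega))
    (fun p => x (p.1 + 1, p.2 + 1))
  have hs := shift x (fun p => MM A p - MM B p) n 1 1 (by simp) (by simp) (by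
    intro i j hij
    rw [MM_zero hA.1 i j hij, MM_zero (n := n - 1)
      (by intro i j hij; exact hB i j (by rw [mem_S] at hij ⊢; omega)) i j
      (by rw [mem_S] at hij ⊢; omega), sub_self])
  have hw : ∏ p ∈ S n, w x p ^ (A (p.1 - 1, p.2 - 1) - B (p.1 - 1, p.2 - 1)) =
      ∏ p ∈ S n, x (p.1 + 1, p.2 + 1) ^ (MM A p - MM B p) := by
    rw [← h, ← hs]
    refine Finset.prod_congr rfl fun p _ => ?_
    congr 1
    simp only [MM]
    ring
  rw [Finset.prod_mul_distrib, hw, ← Finset.prod_mul_distrib]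
  have : ∏ p ∈ S n, (x (p.1 + 1, p.2 + 1) ^ (MM A p - MM B p) *
      (x (p.1 + 1, p.2 + 1) ^ MM A p)⁻¹) = (∏ p ∈ S n, x (p.1 + 1, p.2 + 1) ^ MM B p)⁻¹ := by
    rw [← Finset.prod_inv_distrib]
    refine Finset.prod_congr rfl fun p _ => ?_
    rw [← zpow_neg, ← zpow_neg, ← zpow_add₀ (hx _)]
    congr 1
    ring
  rw [this]
  rw [sub_add_cancel] at hcB
  rw [hcB, Finset.prod_inv_distrib, mul_inv, ← mul_assoc, mul_inv_cancel₀ (hx _), one_mul]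

/-- Summation over the outer layers for a fixed middle layer. -/
lemma fixedA (n : ℤ) (hn : 1 ≤ n) {A : ℤ × ℤ → ℤ} (hA : IsASM n A)
    (x : ℤ × ℤ → K) (hx : ∀ p, x p ≠ 0)
    (hPQ : ∀ p : ℤ × ℤ, x (p.1, p.2) * x (p.1 + 1, p.2 + 1) +
      x (p.1 + 1, p.2) * x (p.1, p.2 + 1) ≠ 0) :
    (∏ p ∈ S n, (x (p.1, p.2) * x (p.1 + 1, p.2 + 1) +
      x (p.1 + 1, p.2) * x (p.1, p.2 + 1)) ^ MM A p) *
      ∑ B ∈ Down n A, ∏ p ∈ S (n - 1), (x (p.1 + 1, p.2 + 1) ^ MM B p)⁻¹ =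
    ∑ C ∈ Up n A, ∏ p ∈ S (n + 1), x p ^ MM C p := by
  have hC : ∑ C ∈ Up n A, ∏ p ∈ S (n + 1), x p ^ MM C p =
      x (n + 1, n + 1) * ∏ p ∈ S n, ∑ c ∈ upI A p, (w x p ^ (c - A p) * x p ^ MM A p) := by
    rw [← sum_PF _ _ dd, Finset.mul_sum]
    exact Finset.sum_congr rfl fun C hC => prod_C n (by omega) hA hC x hx
  have hB : ∑ B ∈ Down n A, ∏ p ∈ S (n - 1), (x (p.1 + 1, p.2 + 1) ^ MM B p)⁻¹ =
      x (n + 1, n + 1) * ∏ p ∈ S n, ∑ b ∈ dnI A (p.1 - 1, p.2 - 1),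
        (w x p ^ (A (p.1 - 1, p.2 - 1) - b) * (x (p.1 + 1, p.2 + 1) ^ MM A p)⁻¹) := by
    have hre : ∀ f : ℤ × ℤ → K, ∏ p ∈ S n, f (p.1 - 1, p.2 - 1) = ∏ q ∈ S0 n, f q := by
      intro f
      refine Finset.prod_bij (fun p _ => (p.1 - 1, p.2 - 1)) ?_ ?_ ?_ ?_
      · rintro ⟨i, j⟩ h
        rw [mem_S] at h
        rw [mem_S0]
        omega
      · rintro ⟨i, j⟩ _ ⟨i', j'⟩ _ h
        simpa using h
      · rintro ⟨i, j⟩ h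
        rw [mem_S0] at h
        exact ⟨(i + 1, j + 1), by rw [mem_S]; omega, by simp⟩
      · intro _ _
        rfl
    have e1 := hre (fun q => ∑ b ∈ dnI A q, (w x (q.1 + 1, q.2 + 1) ^ (A q - b) *
        (x (q.1 + 1 + 1, q.2 + 1 + 1) ^ MM A (q.1 + 1, q.2 + 1))⁻¹))
    simp only [sub_add_cancel] at e1
    rw [e1, ← sum_PF _ _ dd, Finset.mul_sum]
    refine Finset.sum_congr rfl fun B hB => ?_
    have hB' := (swap (n := n - 1) B A).2
      ⟨by rwa [sub_add_cancel], by rw [sub_add_cancel]; exact mem_ASM.2 hA⟩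
    have hB2 := (mem_ASM.1 hB'.1).1
    rw [prod_B n hn hA (by intro i j hij; exact hB2 i j (by rwa [sub_sub])) x hx]
    congr 1
    have e2 := hre (fun q => (w x (q.1 + 1, q.2 + 1) ^ (A q - B q) *
        (x (q.1 + 1 + 1, q.2 + 1 + 1) ^ MM A (q.1 + 1, q.2 + 1))⁻¹))
    simp only [sub_add_cancel] at e2
    exact e2
  rw [hC, hB, mul_left_comm, ← Finset.prod_mul_distrib]
  congr 1
  refine Finset.prod_congr rfl fun p _ => ?_
  obtain ⟨i, j⟩ := p
  have h1 := hA.2 i j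
  have h2 := hA.2 (i - 1) j
  have h3 := hA.2 i (j - 1)
  have hc := cell (x (i, j) * x (i + 1, j + 1)) (x (i + 1, j) * x (i, j + 1))
    (mul_ne_zero (hx _) (hx _)) (hPQ (i, j))
    (A (i - 1, j - 1)) (A (i - 1, j)) (A (i, j - 1)) (A (i, j))
    (by omega) (by omega) (by omega) (by omega) (by omega) (by omega) (by omega) (by omega)
  have hM : MM A (i, j) = A (i, j) + A (i - 1, j - 1) - A (i - 1, j) - A (i, j - 1) := rfl
  rw [← hM] at hc
  simp only [upI, dnI, sub_add_cancel, w] at hc ⊢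
  rw [← Finset.sum_mul, ← Finset.sum_mul, ← mul_assoc, min_comm (A (i, j - 1)), ← hc, mul_zpow]
  have := zpow_ne_zero (MM A (i, j)) (hx (i + 1, j + 1))
  field_simp

/-- One step of the induction. -/
lemma step (n : ℤ) (hn : 1 ≤ n) (x y z : ℤ × ℤ → K) (hx : ∀ p, x p ≠ 0) (hz0 : ∀ p, z p ≠ 0)
    (hz : ∀ p : ℤ × ℤ, z p = (x (p.1, p.2) * x (p.1 + 1, p.2 + 1) +
      x (p.1 + 1, p.2) * x (p.1, p.2 + 1)) / y p) :
    ∑ A ∈ ASM n, (∏ p ∈ S n, z p ^ MM A p) *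
      ∑ B ∈ Down n A, ∏ p ∈ S (n - 1), (x (p.1 + 1, p.2 + 1) ^ MM B p)⁻¹ =
    ∑ C ∈ ASM (n + 1), (∏ p ∈ S (n + 1), x p ^ MM C p) *
      ∑ A ∈ Down (n + 1) C, ∏ p ∈ S n, (y p ^ MM A p)⁻¹ := by
  have hPQ : ∀ p : ℤ × ℤ, x (p.1, p.2) * x (p.1 + 1, p.2 + 1) +
      x (p.1 + 1, p.2) * x (p.1, p.2 + 1) ≠ 0 := by
    intro p h
    apply hz0 p
    rw [hz, h, zero_div]
  have h1 : ∀ A ∈ ASM n, (∏ p ∈ S n, z p ^ MM A p) *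
      ∑ B ∈ Down n A, ∏ p ∈ S (n - 1), (x (p.1 + 1, p.2 + 1) ^ MM B p)⁻¹ =
      ∑ C ∈ Up n A, (∏ p ∈ S (n + 1), x p ^ MM C p) * ∏ p ∈ S n, (y p ^ MM A p)⁻¹ := by
    intro A hA
    rw [← Finset.sum_mul, ← fixedA n hn (mem_ASM.1 hA) x hx hPQ, mul_right_comm,
      ← Finset.prod_mul_distrib]
    congr 1
    refine Finset.prod_congr rfl fun p _ => ?_
    rw [hz, div_zpow, div_eq_mul_inv]
  rw [Finset.sum_congr rfl h1]
  simp_rw [Finset.mul_sum]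
  exact Finset.sum_comm' fun A C => swap A C

lemma base (z x : ℤ × ℤ → K) :
    ∑ A ∈ ASM 1, (∏ p ∈ S 1, z p ^ MM A p) *
      ∑ B ∈ Down 1 A, ∏ p ∈ S (1 - 1), (x (p.1 + 1, p.2 + 1) ^ MM B p)⁻¹ = z (1, 1) := by
  have hS : S (1 - 1) = ∅ := by simp [S]
  have hdd : Incr dd := by
    intro i j
    simp only [dd]
    omega
  have hA : ASM 1 = {dd} := by
    ext A
    rw [mem_ASM, Finset.mem_singleton]
    constructor
    · intro h
      funext p
      exact h.1 p.1 p.2 (by rw [hS]; simp)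
    · rintro rfl
      exact ⟨fun _ _ _ => rfl, hdd⟩
  have hD : Down 1 dd = {dd} := by
    ext B
    unfold Down
    rw [mem_PF, Finset.mem_singleton]
    constructor
    · rintro ⟨h1, h2⟩
      funext p
      obtain ⟨i, j⟩ := p
      by_cases h : (i, j) ∈ S0 1
      · have h1 := h1 _ h
        rw [mem_S0] at h
        simp only [dnI, dd, Finset.mem_Icc] at h1 ⊢
        omega
      · exact h2 _ h
    · rintro rfl
      refine ⟨?_, fun _ _ => rfl⟩
      rintro ⟨i, j⟩ h
      rw [mem_S0] at h
      simp only [dnI, dd, Finset.mem_Icc]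
      omega
  rw [hA, Finset.sum_singleton, hD, Finset.sum_singleton, hS]
  simp [S, MM, dd]

end prods

/-! ### Nonvanishing -/

/-- Quotients of polynomials positive at the all-ones point. -/
def Pos (t : TSystemField) : Prop :=
  ∃ f g : MvPolynomial (ℤ × ℤ) ℚ, 0 < MvPolynomial.eval (fun _ => 1) f ∧
    0 < MvPolynomial.eval (fun _ => 1) g ∧
    t = algebraMap _ TSystemField f / algebraMap _ TSystemField g

lemma alg_ne {f : MvPolynomial (ℤ × ℤ) ℚ} (h : 0 < MvPolynomial.eval (fun _ => 1) f) :
    algebraMap _ TSystemField f ≠ 0 := by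
  intro h0
  have : f = 0 := (IsFractionRing.injective (MvPolynomial (ℤ × ℤ) ℚ) TSystemField)
    (by rw [h0, map_zero])
  rw [this] at h
  simp at h

lemma Pos.ne {t : TSystemField} (h : Pos t) : t ≠ 0 := by
  obtain ⟨f, g, hf, hg, rfl⟩ := h
  exact div_ne_zero (alg_ne hf) (alg_ne hg)

lemma Pos.mul {s t : TSystemField} (hs : Pos s) (ht : Pos t) : Pos (s * t) := by
  obtain ⟨f, g, hf, hg, rfl⟩ := hs
  obtain ⟨f', g', hf', hg', rfl⟩ := ht
  refine ⟨f * f', g * g', ?_, ?_, ?_⟩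
  · rw [map_mul]; positivity
  · rw [map_mul]; positivity
  · rw [map_mul, map_mul, div_mul_div_comm]

lemma Pos.add {s t : TSystemField} (hs : Pos s) (ht : Pos t) : Pos (s + t) := by
  obtain ⟨f, g, hf, hg, rfl⟩ := hs
  obtain ⟨f', g', hf', hg', rfl⟩ := ht
  refine ⟨f * g' + g * f', g * g', ?_, ?_, ?_⟩
  · rw [map_add, map_mul, map_mul]; positivity
  · rw [map_mul]; positivity
  · rw [div_add_div _ _ (alg_ne hg) (alg_ne hg'), map_add, map_mul, map_mul, map_mul]

lemma Pos.div {s t : TSystemField} (hs : Pos s) (ht : Pos t) : Pos (s / t) := by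
  obtain ⟨f', g', hf', hg', rfl⟩ := ht
  rw [div_eq_mul_inv, inv_div]
  exact hs.mul ⟨g', f', hg', hf', rfl⟩

lemma Pos.one : Pos 1 := ⟨1, 1, by simp, by simp, by simp⟩

lemma Pos.tVar (i j : ℤ) : Pos (tVar i j) :=
  ⟨MvPolynomial.X (i, j), 1, by simp, by simp, by simp [_root_.tVar]⟩

end TSys

/-- positive Laurent property of the octahedron recurrence.
If `T` solves the T-system `T_{i,j,k+1} = (T_{i,j+1,k} T_{i,j-1,k} + T_{i+1,j,k} T_{i-1,j,k}) / T_{i,j,k-1}`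
with initial data `T_{i,j,0} = 1` (`i+j` even) and `T_{i,j,1} = x_{i,j}` (`i+j` odd),
then every `T_{i,j,k}` (with `i+j+k` even) lies in the subsemiring of the field of
rational functions generated by the variables `x_{i,j}` and their inverses, i.e. it
is a Laurent polynomial with nonnegative integer coefficients. -/
theorem tsystem_positive_laurent
    (T : ℤ → ℤ → ℕ → TSystemField)
    (h0 : ∀ i j : ℤ, (i + j) % 2 = 0 → T i j 0 = 1)
    (h1 : ∀ i j : ℤ, (i + j) % 2 ≠ 0 → T i j 1 = tVar i j)
    (hrec : ∀ (i j : ℤ) (k : ℕ), 1 ≤ k → (i + j + (k : ℤ) + 1) % 2 = 0 →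
      T i j (k + 1) =
        (T i (j + 1) k * T i (j - 1) k + T (i + 1) j k * T (i - 1) j k) / T i j (k - 1)) :
    ∀ (i j : ℤ) (k : ℕ), (i + j + (k : ℤ)) % 2 = 0 →
      T i j k ∈ Subsemiring.closure
        (Set.range (fun v : ℤ × ℤ => tVar v.1 v.2) ∪
          Set.range (fun v : ℤ × ℤ => (tVar v.1 v.2)⁻¹)) := by
  have hpos : ∀ (k : ℕ) (i j : ℤ), (i + j + (k : ℤ)) % 2 = 0 → TSys.Pos (T i j k) := by
    intro k
    induction k using Nat.strong_induction_on with
    | _ k ih =>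
      intro i j h
      match k, ih, h with
      | 0, _, h =>
        rw [h0 i j (by simpa using h)]
        exact TSys.Pos.one
      | 1, _, h =>
        rw [h1 i j (by push_cast at h; omega)]
        exact TSys.Pos.tVar i j
      | k + 2, ih, h =>
        push_cast at h
        rw [hrec i j (k + 1) (by omega) (by push_cast; omega)]
        have e1 := ih (k + 1) (by omega) i (j + 1) (by push_cast; omega)
        have e2 := ih (k + 1) (by omega) i (j - 1) (by push_cast; omega)
        have e3 := ih (k + 1) (by omega) (i + 1) j (by push_cast; omega)
        have e4 := ih (k + 1) (by omega) (i - 1) j (by push_cast; omega)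
        have e5 := ih k (by omega) i j (by omega)
        exact ((e1.mul e2).add (e3.mul e4)).div (by simpa using e5)
  intro i j k hk
  rcases Nat.eq_zero_or_pos k with rfl | hkpos
  · rw [h0 i j (by simpa using hk)]
    exact one_mem _
  have hT : ∀ {a a' b b' : ℤ} (l : ℕ), a = a' → b = b' → T a b l = T a' b' l := by
    rintro a _ b _ l rfl rfl
    rfl
  -- the expansion in terms of the layers `l` and `l + 1`
  have main : ∀ n : ℕ, ∀ l : ℕ, n + 1 + l = k →
      T i j k = ∑ A ∈ TSys.ASM ((n : ℤ) + 1),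
        (∏ p ∈ TSys.S ((n : ℤ) + 1),
          T (i + p.1 - p.2) (j + p.1 + p.2 - (n + 1) - 1) (l + 1) ^ TSys.MM A p) *
        ∑ B ∈ TSys.Down ((n : ℤ) + 1) A, ∏ p ∈ TSys.S (n : ℤ),
          (T (i + p.1 - p.2) (j + p.1 + p.2 - n - 1) l ^ TSys.MM B p)⁻¹ := by
    intro n
    induction n with
    | zero =>
      intro l hl
      have := TSys.base (K := TSystemField)
        (fun p => T (i + p.1 - p.2) (j + p.1 + p.2 - 1 - 1) (l + 1))
        (fun p => T (i + (p.1 - 1) - (p.2 - 1)) (j + (p.1 - 1) + (p.2 - 1) - 1) l)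
      simp only [add_sub_cancel_right, sub_self] at this
      simp only [Nat.cast_zero, zero_add, sub_zero]
      rw [this, ← hl]
      congr 1
      omega
    | succ n ih =>
      intro l hl
      rw [ih (l + 1) (by omega)]
      have := TSys.step (K := TSystemField) ((n : ℤ) + 1) (by omega)
        (fun p => T (i + p.1 - p.2) (j + p.1 + p.2 - (n + 1 + 1) - 1) (l + 1))
        (fun p => T (i + p.1 - p.2) (j + p.1 + p.2 - (n + 1) - 1) l)
        (fun p => T (i + p.1 - p.2) (j + p.1 + p.2 - (n + 1) - 1) (l + 1 + 1))
        (fun p => (hpos _ _ _ (by push_cast; omega)).ne)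
        (fun p => (hpos _ _ _ (by push_cast; omega)).ne)
        (by
          rintro ⟨a, b⟩
          simp only
          rw [hrec _ _ (l + 1) (by omega) (by push_cast; omega), Nat.add_sub_cancel,
            mul_comm (T _ (_ + 1) _)]
          refine congrArg₂ (· / ·) (congrArg₂ (· + ·) (congrArg₂ (· * ·) ?_ ?_)
            (congrArg₂ (· * ·) ?_ ?_)) rfl <;> exact hT _ (by ring) (by ring))
      simp only [add_sub_cancel_right] at this
      push_cast
      rw [← this]
      refine Finset.sum_congr rfl fun A _ => ?_
      refine congrArg₂ (· * ·) rfl ?_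
      refine Finset.sum_congr rfl fun B _ => Finset.prod_congr rfl fun p _ => ?_
      rw [hT (l + 1) (show i + p.1 - p.2 = i + (p.1 + 1) - (p.2 + 1) by ring)
        (show j + p.1 + p.2 - n - 1 = j + (p.1 + 1) + (p.2 + 1) - (n + 1 + 1) - 1 by ring)]
  obtain ⟨n, rfl⟩ : ∃ n, k = n + 1 := ⟨k - 1, by omega⟩
  rw [main n 0 rfl]
  refine sum_mem fun A _ => mul_mem (prod_mem fun p _ => ?_) (sum_mem fun B _ => prod_mem fun p _ => ?_)
  · rw [zero_add, h1 _ _ (by push_cast at hk; omega)]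
    cases TSys.MM A p with
    | ofNat m =>
      rw [Int.ofNat_eq_natCast, zpow_natCast]
      refine pow_mem (Subsemiring.subset_closure ?_) m
      exact Or.inl ⟨(_, _), rfl⟩
    | negSucc m =>
      rw [zpow_negSucc, ← inv_pow]
      refine pow_mem (Subsemiring.subset_closure ?_) _
      exact Or.inr ⟨(_, _), rfl⟩
  · rw [h0 _ _ (by push_cast at hk; omega)]
    simp
end
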